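/- Let Λ_Φ be a good sponge such that for every i ∈ D the contraction ratio |φ'_{i,a}| does not depend on a ∈ A_i. Then HD(Λ_Φ) = DynD(Φ). -/

import Mathlib

open MeasureTheory Filter Set Metric
open scoped Classical Topology ENNReal NNReal

namespace SelfAffineSponge

/-- A diagonal IFS on `[0,1]^d`: for each coordinate `i ∈ D = Fin d` a finite alphabet
`A i` indexing affine maps `x ↦ slope i a * x + off i a` of `[0,1]`, together with a
set `E ⊆ ∏ i, A i` of allowed tuples of symbols. -/
structure DiagIFS (d : ℕ) (A : Fin d → Type) [∀ i, Fintype (A i)] where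
  slope : ∀ i : Fin d, A i → ℝ
  off : ∀ i : Fin d, A i → ℝ
  E : Finset (∀ i, A i)

variable {d : ℕ} {A : Fin d → Type} [∀ i, Fintype (A i)]

namespace DiagIFS

/-- the base similarity `φ_{i,a}` in coordinate `i` -/
def base (Φ : DiagIFS d A) (i : Fin d) (a : A i) (x : ℝ) : ℝ :=
  Φ.slope i a * x + Φ.off i a

/-- the data defines an honest diagonal IFS: `E` is nonempty and each base map is a
contracting similarity of `[0,1]` -/
def Valid (Φ : DiagIFS d A) : Prop :=
  Φ.E.Nonempty ∧ (∀ i a, Φ.slope i a ≠ 0) ∧ (∀ i a, |Φ.slope i a| < 1) ∧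
    ∀ i a, ∀ x ∈ Set.Icc (0:ℝ) 1, Φ.base i a x ∈ Set.Icc (0:ℝ) 1

/-- the alphabet `E` of the IFS, as a type -/
abbrev Symb (Φ : DiagIFS d A) : Type _ := {a : ∀ i, A i // a ∈ Φ.E}

instance (Φ : DiagIFS d A) : MeasurableSpace Φ.Symb := ⊤
instance (Φ : DiagIFS d A) : TopologicalSpace Φ.Symb := ⊥

/-- the affine contraction `φ_a` of `[0,1]^d` associated to a tuple of symbols -/
def affMap (Φ : DiagIFS d A) (a : ∀ i, A i) (x : Fin d → ℝ) : Fin d → ℝ :=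
  fun i => Φ.base i (a i) (x i)

/-- the coding map `π(ω) = lim_n φ_{ω_0}∘⋯∘φ_{ω_{n-1}}(0)`, written in closed form -/
noncomputable def coding (Φ : DiagIFS d A) (ω : ℕ → Φ.Symb) : Fin d → ℝ :=
  fun i => ∑' n : ℕ, (∏ k ∈ Finset.range n, Φ.slope i ((ω k).1 i)) * Φ.off i ((ω n).1 i)

/-- the limit set `Λ_Φ = π(E^ℕ)` (the self-affine sponge) -/
def limitSet (Φ : DiagIFS d A) : Set (Fin d → ℝ) :=
  Set.range Φ.coding

theorem coding_mem (Φ : DiagIFS d A) (ω : ℕ → Φ.Symb) : Φ.coding ω ∈ Φ.limitSet :=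
  ⟨ω, rfl⟩

/-- the `i`-th Lyapunov exponent `χ_i(p) = -∫ log|φ'_{a,i}| dp(a)` of a finite measure
`p` on `E` (given by its density) -/
noncomputable def chi (Φ : DiagIFS d A) (i : Fin d) (p : Φ.Symb → ℝ) : ℝ :=
  -∑ a : Φ.Symb, p a * Real.log |Φ.slope i (a.1 i)|

/-- the mass `p([a]_I)` of the cylinder `[a]_I = {b ∈ E : b_i = a_i ∀ i ∈ I}` -/
noncomputable def cylMass (Φ : DiagIFS d A) (I : Finset (Fin d)) (p : Φ.Symb → ℝ)
    (a : Φ.Symb) : ℝ :=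
  ∑ b : Φ.Symb, if ∀ i ∈ I, b.1 i = a.1 i then p b else 0

/-- the entropy `h(I; p) = -∫ log p([a]_I) dp(a)` -/
noncomputable def entropy (Φ : DiagIFS d A) (I : Finset (Fin d)) (p : Φ.Symb → ℝ) : ℝ :=
  -∑ a : Φ.Symb, p a * Real.log (Φ.cylMass I p a)

/-- the conditional entropy `h(I' | I; p) = h(I';p) - h(I;p)` -/
noncomputable def condEntropy (Φ : DiagIFS d A) (I I' : Finset (Fin d))
    (p : Φ.Symb → ℝ) : ℝ :=
  Φ.entropy I' p - Φ.entropy I p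

/-- a coordinate set `I ⊆ D` is good if the projected IFS `Φ_I` satisfies the open set
condition: the boxes `φ_{I,a}((0,1)^I)`, indexed by distinct projections of elements of
`E`, are pairwise disjoint (equivalently, some coordinate has disjoint intervals). -/
def GoodIdx (Φ : DiagIFS d A) (I : Finset (Fin d)) : Prop :=
  ∀ a ∈ Φ.E, ∀ b ∈ Φ.E, (∃ i ∈ I, a i ≠ b i) →
    ∃ i ∈ I, Disjoint (Φ.base i (a i) '' Set.Ioo (0:ℝ) 1)
      (Φ.base i (b i) '' Set.Ioo (0:ℝ) 1)

/-- Barański condition: each base IFS satisfies the open set condition w.r.t. `(0,1)` -/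
def Baranski (Φ : DiagIFS d A) : Prop :=
  ∀ i : Fin d, ∀ a b : A i, a ≠ b →
    Disjoint (Φ.base i a '' Set.Ioo (0:ℝ) 1) (Φ.base i b '' Set.Ioo (0:ℝ) 1)

/-- strong Barański condition: each base IFS satisfies the strong separation condition
w.r.t. `[0,1]` -/
def StronglyBaranski (Φ : DiagIFS d A) : Prop :=
  ∀ i : Fin d, ∀ a b : A i, a ≠ b →
    Disjoint (Φ.base i a '' Set.Icc (0:ℝ) 1) (Φ.base i b '' Set.Icc (0:ℝ) 1)

/-- coordinate ordering condition: some permutation `σ` of the coordinates has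
`|φ'_{a,σ(1)}| > ⋯ > |φ'_{a,σ(d)}|` for all `a ∈ E` -/
def CoordOrdering (Φ : DiagIFS d A) : Prop :=
  ∃ σ : Equiv.Perm (Fin d), ∀ a ∈ Φ.E, ∀ i j : Fin d, i < j →
    |Φ.slope (σ j) (a (σ j))| < |Φ.slope (σ i) (a (σ i))|

end DiagIFS

/-- a probability vector (probability measure on a finite set, via its density) -/
def IsProbVec {α : Type*} [Fintype α] (p : α → ℝ) : Prop :=
  (∀ a, 0 ≤ p a) ∧ ∑ a, p a = 1

/-- a measure `p` on `E` is good if `I(p,x) = {i : χ_i(p) ≤ x}` is good for all `x > 0` -/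
def DiagIFS.GoodVec (Φ : DiagIFS d A) (p : Φ.Symb → ℝ) : Prop :=
  ∀ x > 0, Φ.GoodIdx (Finset.univ.filter fun i => Φ.chi i p ≤ x)

/-- a cycle on `E`: a continuous exponentially `λ`-periodic map `(0,∞) → P`,
where `λ = 1` means constant -/
structure Cycle (Φ : DiagIFS d A) where
  lam : ℝ
  one_le_lam : 1 ≤ lam
  r : ℝ → Φ.Symb → ℝ
  prob : ∀ b > 0, IsProbVec (r b)
  cont : ContinuousOn r (Set.Ioi 0)
  periodic : ∀ b > 0, r (lam * b) = r b
  const_of_lam_eq_one : lam = 1 → ∀ b > 0, ∀ b' > 0, r b = r b'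

/-- the number `B_i`, determined by `B = ∫_0^{B_i} χ_i(r_b) db` (written via `sInf`;
for a cycle the function `x ↦ ∫_0^x χ_i(r_b) db` is continuous and strictly
increasing, so the infimum is the unique solution) -/
noncomputable def Bcoord (Φ : DiagIFS d A) (r : ℝ → Φ.Symb → ℝ) (B : ℝ) (i : Fin d) : ℝ :=
  sInf {x : ℝ | 0 ≤ x ∧ B ≤ ∫ b in Set.Ioc (0:ℝ) x, Φ.chi i (r b)}

/-- `δ(r, B) = B⁻¹ ∫_0^∞ h({i : b ≤ B_i}; r_b) db` -/
noncomputable def deltaRB (Φ : DiagIFS d A) (r : ℝ → Φ.Symb → ℝ) (B : ℝ) : ℝ :=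
  B⁻¹ * ∫ b in Set.Ioi (0:ℝ),
    Φ.entropy (Finset.univ.filter fun i => b ≤ Bcoord Φ r B i) (r b)

/-- `δ(r) = inf_{B ∈ [1,λ]} δ(r,B)` -/
noncomputable def Cycle.delta {Φ : DiagIFS d A} (c : Cycle Φ) : ℝ :=
  sInf (deltaRB Φ c.r '' Set.Icc 1 c.lam)

/-- `δ(p) = ∫_0^∞ h({i : b ≤ 1/χ_i(p)}; p) db` -/
noncomputable def deltaP (Φ : DiagIFS d A) (p : Φ.Symb → ℝ) : ℝ :=
  ∫ b in Set.Ioi (0:ℝ),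
    Φ.entropy (Finset.univ.filter fun i => b ≤ (Φ.chi i p)⁻¹) p

/-- the normalized average `R̂_B = B⁻¹ ∫_0^B r_b db` of a cycle -/
noncomputable def cycleAvg {Φ : DiagIFS d A} (c : Cycle Φ) (B : ℝ) : Φ.Symb → ℝ :=
  fun a => B⁻¹ * ∫ b in Set.Ioc (0:ℝ) B, c.r b a

/-- a cycle is good if all its normalized averages `R̂_B` are good -/
def Cycle.Good {Φ : DiagIFS d A} (c : Cycle Φ) : Prop :=
  ∀ B > 0, Φ.GoodVec (cycleAvg c B)

/-- a cycle is nondegenerate if `{b > 0 : r_b(a) > 0 ∀ a ∈ E_r}` is dense in `(0,∞)` -/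
def Cycle.Nondeg {Φ : DiagIFS d A} (c : Cycle Φ) : Prop :=
  Set.Ioi (0:ℝ) ⊆
    closure {b : ℝ | 0 < b ∧ ∀ a : Φ.Symb, (∃ b' > 0, 0 < c.r b' a) → 0 < c.r b a}

/-- the lower pointwise dimension `d̲(x,μ) = liminf_{ρ→0} log μ(B(x,ρ))/log ρ` -/
noncomputable def lowerPtDim {X : Type*} [PseudoMetricSpace X] [MeasurableSpace X]
    (μ : Measure X) (x : X) : ℝ≥0∞ :=
  Filter.liminf
    (fun ρ : ℝ => ENNReal.ofReal (Real.log (μ (Metric.ball x ρ)).toReal / Real.log ρ))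
    (𝓝[>] (0:ℝ))

/-- the Hausdorff dimension of a measure: the essential supremum of its lower
pointwise dimension -/
noncomputable def measDim {X : Type*} [PseudoMetricSpace X] [MeasurableSpace X]
    (μ : Measure X) : ℝ≥0∞ :=
  essSup (lowerPtDim μ) μ

/-- the shift map on `E^ℕ` -/
def shift {α : Type*} (ω : ℕ → α) : ℕ → α := fun n => ω (n + 1)

/-- the dynamical dimension: the supremum of `HD(π_*μ)` over shift-invariant
probability measures `μ` on `E^ℕ` -/
noncomputable def DiagIFS.dynDim (Φ : DiagIFS d A) : ℝ≥0∞ :=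
  sSup {x : ℝ≥0∞ | ∃ μ : Measure (ℕ → Φ.Symb), IsProbabilityMeasure μ ∧
    Measure.map shift μ = μ ∧ x = measDim (Measure.map Φ.coding μ)}

/-- `μ` is the product measure on `E^ℕ` whose `k`-th factor has density `p k`
(this property characterizes `μ` uniquely) -/
def IsProductMeasure (Φ : DiagIFS d A) (p : ℕ → Φ.Symb → ℝ)
    (μ : Measure (ℕ → Φ.Symb)) : Prop :=
  IsProbabilityMeasure μ ∧
    ∀ (n : ℕ) (w : ℕ → Φ.Symb),
      (μ {ω | ∀ k < n, ω k = w k}).toReal = ∏ k ∈ Finset.range n, p k (w k)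

/-- the set of Hausdorff dimensions of Bernoulli measures `ν_p = π_*[p^ℕ]` -/
noncomputable def bernoulliDims (Φ : DiagIFS d A) : Set ℝ≥0∞ :=
  {x | ∃ p : Φ.Symb → ℝ, IsProbVec p ∧ ∃ μ : Measure (ℕ → Φ.Symb),
    IsProductMeasure Φ (fun _ => p) μ ∧ x = measDim (Measure.map Φ.coding μ)}

/-- the set of Hausdorff dimensions of pseudo-Bernoulli measures
`ν_r = π_*[∏_n r_n]` -/
noncomputable def pseudoBernoulliDims (Φ : DiagIFS d A) : Set ℝ≥0∞ :=
  {x | ∃ c : Cycle Φ, ∃ μ : Measure (ℕ → Φ.Symb),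
    IsProductMeasure Φ (fun n => c.r ((n : ℝ) + 1)) μ ∧
      x = measDim (Measure.map Φ.coding μ)}

/-- If a finite measure gives mass at least `c * ρ ^ s` to arbitrarily small balls around each
point of a set, then the set has Hausdorff dimension at most `s`. -/
theorem dimH_le_of_exists_le_measure_ball {X : Type*} [MetricSpace X] [MeasurableSpace X]
    [BorelSpace X] (ν : Measure X) [IsFiniteMeasure ν] (S : Set X) (s : ℝ≥0) (c : ℝ) (hc : 0 < c)
    (h : ∀ x ∈ S, ∀ R > 0, ∃ ρ, 0 < ρ ∧ ρ < R ∧ ENNReal.ofReal (c * ρ ^ (s : ℝ)) ≤ ν (ball x ρ)) :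
    dimH S ≤ s := by
  refine dimH_le_of_hausdorffMeasure_ne_top (ne_top_of_le_ne_top
    (b := ENNReal.ofReal (10 ^ (s : ℝ) / c) * ν univ) ?_ ?_)
  · exact ENNReal.mul_ne_top ENNReal.ofReal_ne_top (measure_ne_top _ _)
  have key : ∀ n : ℕ, ∃ u : Set X, ∃ ρ : X → ℝ, u.Countable ∧
      S ⊆ ⋃ x : u, closedBall x.1 (5 * ρ x) ∧
      (∀ x ∈ u, 0 < ρ x ∧ ρ x < 1 / (n + 1)) ∧
      ∑' x : u, ENNReal.ofReal (c * ρ x ^ (s : ℝ)) ≤ ν univ := by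
    intro n
    have hn : (0 : ℝ) < 1 / (n + 1) := by positivity
    have h' : ∀ x : X, ∃ ρ : ℝ, x ∈ S →
        0 < ρ ∧ ρ < 1 / (n + 1) ∧ ENNReal.ofReal (c * ρ ^ (s : ℝ)) ≤ ν (ball x ρ) := by
      intro x
      by_cases hx : x ∈ S
      · obtain ⟨ρ, h1⟩ := h x hx _ hn
        exact ⟨ρ, fun _ => h1⟩
      · exact ⟨0, fun hx' => absurd hx' hx⟩
    choose ρ hρ using h'
    obtain ⟨u, huS, hdisj, hcov⟩ := Vitali.exists_disjoint_subfamily_covering_enlargement_closedBall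
      S id ρ (1 / (n + 1)) (fun x hx => (hρ x hx).2.1.le) 5 (by norm_num)
    have hd : Pairwise (Function.onFun Disjoint fun x : u => closedBall x.1 (ρ x)) := by
      intro x y hxy
      exact hdisj x.2 y.2 (fun hh => hxy (Subtype.ext hh))
    have hpos : ∀ x : u, ENNReal.ofReal (c * ρ x ^ (s : ℝ)) ≤ ν (closedBall x.1 (ρ x)) := fun x =>
      (hρ x (huS x.2)).2.2.trans (measure_mono ball_subset_closedBall)
    have hcount : Countable u := by
      have := Measure.countable_meas_pos_of_disjoint_iUnion₀ (μ := ν)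
        (As := fun x : u => closedBall x.1 (ρ x))
        (fun x => isClosed_closedBall.measurableSet.nullMeasurableSet)
        (fun x y hxy => (hd hxy).aedisjoint)
      have huniv : {x : u | 0 < ν (closedBall x.1 (ρ x))} = univ := by
        refine eq_univ_of_forall fun x => lt_of_lt_of_le ?_ (hpos x)
        have := (hρ x (huS x.2)).1
        simp only [ENNReal.ofReal_pos]
        positivity
      rw [huniv] at this
      exact countable_univ_iff.1 this
    refine ⟨u, ρ, hcount, ?_, fun x hx => ⟨(hρ x (huS hx)).1, (hρ x (huS hx)).2.1⟩, ?_⟩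
    · intro x hx
      obtain ⟨y, hy, hxy⟩ := hcov x hx
      exact mem_iUnion.2 ⟨⟨y, hy⟩, hxy (mem_closedBall_self (hρ x hx).1.le)⟩
    · calc _ ≤ ∑' x : u, ν (closedBall x.1 (ρ x)) := ENNReal.tsum_le_tsum hpos
        _ = ν (⋃ x : u, closedBall x.1 (ρ x)) :=
          (measure_iUnion hd fun x => isClosed_closedBall.measurableSet).symm
        _ ≤ ν univ := measure_mono (subset_univ _)
  choose u ρ hcount hcov hρ hsum using key
  have : ∀ n, Countable (u n) := fun n => (hcount n).to_subtype
  have hdiam : ∀ n, ∀ x : u n,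
      ediam (closedBall x.1 (5 * ρ n x)) ≤ ENNReal.ofReal (10 * ρ n x) := by
    intro n x
    have h0 := (hρ n x x.2).1
    calc _ ≤ 2 * ENNReal.ofReal (5 * ρ n x) := by
          rw [← Metric.closedEBall_ofReal (by positivity)]
          exact Metric.ediam_closedEBall_le
      _ = ENNReal.ofReal (10 * ρ n x) := by
          rw [← ENNReal.ofReal_ofNat 2, ← ENNReal.ofReal_mul (by norm_num)]
          congr 1; ring
  refine (Measure.hausdorffMeasure_le_liminf_tsum (s : ℝ) S (l := atTop)
    (fun n : ℕ => ENNReal.ofReal (10 * (1 / (n + 1)))) ?_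
    (fun n (x : u n) => closedBall x.1 (5 * ρ n x))
    (Eventually.of_forall fun n x => (hdiam n x).trans
      (ENNReal.ofReal_le_ofReal (by linarith [(hρ n x x.2).2])))
    (Eventually.of_forall hcov)).trans ?_
  · rw [← ENNReal.ofReal_zero]
    refine ENNReal.tendsto_ofReal ?_
    simpa using (tendsto_one_div_add_atTop_nhds_zero_nat (𝕜 := ℝ)).const_mul 10
  · refine liminf_le_of_le (by isBoundedDefault) fun b hb => ?_
    obtain ⟨n, hn⟩ := hb.exists
    refine hn.trans ?_
    calc _ ≤ ∑' x : u n, ENNReal.ofReal (10 ^ (s : ℝ) / c) *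
              ENNReal.ofReal (c * ρ n x ^ (s : ℝ)) := by
          refine ENNReal.tsum_le_tsum fun x => ?_
          have h0 := (hρ n x x.2).1
          refine (ENNReal.rpow_le_rpow (hdiam n x) s.coe_nonneg).trans ?_
          rw [ENNReal.ofReal_rpow_of_nonneg (by positivity) s.coe_nonneg,
            ← ENNReal.ofReal_mul (by positivity), Real.mul_rpow (by norm_num) h0.le]
          refine ENNReal.ofReal_le_ofReal (le_of_eq ?_)
          rw [div_mul_eq_mul_div, eq_div_iff hc.ne']
          ring
      _ = ENNReal.ofReal (10 ^ (s : ℝ) / c) * ∑' x : u n, ENNReal.ofReal (c * ρ n x ^ (s : ℝ)) :=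
          ENNReal.tsum_mul_left
      _ ≤ _ := by gcongr; exact hsum n

/-- The mass distribution principle: if small balls centred in `S` have mass at most `C * ρ ^ s`
and `S` is not null, then `S` has Hausdorff dimension at least `s`. -/
theorem le_dimH_of_measure_ball_le {X : Type*} [MetricSpace X] [MeasurableSpace X]
    [BorelSpace X] (ν : Measure X) (S : Set X) (s : ℝ≥0) (C ρ₀ : ℝ) (hC : 0 < C)
    (hρ₀ : 0 < ρ₀)
    (h : ∀ x ∈ S, ∀ ρ, 0 < ρ → ρ < ρ₀ → ν (ball x ρ) ≤ ENNReal.ofReal (C * ρ ^ (s : ℝ)))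
    (hS : ν S ≠ 0) : (s : ℝ≥0∞) ≤ dimH S := by
  rcases eq_or_ne s 0 with rfl | hs
  · simp
  have hs0 : (0 : ℝ) < s := by positivity
  refine le_dimH_of_hausdorffMeasure_ne_zero fun h0 => hS ?_
  set k : ℝ≥0∞ := ENNReal.ofReal ((C * 2 ^ (s : ℝ))⁻¹) with hk
  have hk0 : k ≠ 0 := by
    have : 0 < (C * 2 ^ (s : ℝ))⁻¹ := by positivity
    simpa [hk] using this
  have hle : k • ν.restrict S ≤ μH[(s : ℝ)] := by
    refine Measure.le_hausdorffMeasure _ _ (ENNReal.ofReal (ρ₀ / 4)) (by simpa using hρ₀) ?_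
    intro t ht
    rw [← Metric.ediam_closure t] at ht ⊢
    refine (measure_mono subset_closure).trans ?_
    have hm : MeasurableSet (closure t) := isClosed_closure.measurableSet
    rw [Measure.smul_apply, Measure.restrict_apply hm, smul_eq_mul]
    rcases (closure t ∩ S).eq_empty_or_nonempty with he | ⟨x, hxt, hxS⟩
    · simp [he]
    have hfin : ediam (closure t) ≠ ⊤ := ne_top_of_le_ne_top ENNReal.ofReal_ne_top ht
    set δ := (ediam (closure t)).toReal with hδ
    have hδ0 : 0 ≤ δ := ENNReal.toReal_nonneg
    have hδe : ediam (closure t) = ENNReal.ofReal δ := (ENNReal.ofReal_toReal hfin).symm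
    have hδle : δ ≤ ρ₀ / 4 := by
      rw [hδe] at ht
      exact (ENNReal.ofReal_le_ofReal_iff (by positivity)).1 ht
    have hball : ∀ η, δ < η → η < ρ₀ →
        ν (closure t ∩ S) ≤ ENNReal.ofReal (C * η ^ (s : ℝ)) := by
      intro η h1 h2
      refine (measure_mono ?_).trans (h x hxS η (by linarith) h2)
      intro y hy
      rw [mem_ball, dist_edist]
      refine lt_of_le_of_lt (ENNReal.toReal_mono hfin ?_) h1
      exact Metric.edist_le_ediam_of_mem hy.1 hxt
    have hlim : ν (closure t ∩ S) ≤ ENNReal.ofReal (C * δ ^ (s : ℝ)) := by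
      have ht : Tendsto (fun η : ℝ => ENNReal.ofReal (C * η ^ (s : ℝ))) (𝓝[>] δ)
          (𝓝 (ENNReal.ofReal (C * δ ^ (s : ℝ)))) := by
        refine (ENNReal.continuous_ofReal.tendsto _).comp ?_
        refine Tendsto.mono_left ?_ nhdsWithin_le_nhds
        exact ((Real.continuousAt_rpow_const δ _ (Or.inr hs0.le)).tendsto).const_mul C
      refine ge_of_tendsto ht ?_
      filter_upwards [Ioo_mem_nhdsGT (show δ < ρ₀ by linarith)] with η hη
      exact hball η hη.1 hη.2
    calc k * ν (closure t ∩ S) ≤ k * ENNReal.ofReal (C * δ ^ (s : ℝ)) := by gcongr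
      _ = ENNReal.ofReal ((C * 2 ^ (s : ℝ))⁻¹ * (C * δ ^ (s : ℝ))) :=
        (ENNReal.ofReal_mul (by positivity)).symm
      _ ≤ ENNReal.ofReal (δ ^ (s : ℝ)) := by
        refine ENNReal.ofReal_le_ofReal ?_
        have h2 : (1 : ℝ) ≤ 2 ^ (s : ℝ) := Real.one_le_rpow (by norm_num) hs0.le
        have h3 : 0 ≤ δ ^ (s : ℝ) := by positivity
        have : (C * 2 ^ (s : ℝ))⁻¹ * (C * δ ^ (s : ℝ)) = δ ^ (s : ℝ) / 2 ^ (s : ℝ) := by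
          field_simp
        rw [this]
        exact div_le_self h3 h2
      _ = ediam (closure t) ^ (s : ℝ) := by
        rw [hδe, ENNReal.ofReal_rpow_of_nonneg hδ0 hs0.le]
  have h1 := hle S
  rw [h0, Measure.smul_apply, Measure.restrict_apply_self, smul_eq_mul] at h1
  exact (mul_eq_zero.1 (le_antisymm h1 bot_le)).resolve_left hk0

/-- A measure carried by `S` has dimension at most that of `S`. -/
theorem measDim_le_dimH {X : Type*} [MetricSpace X] [MeasurableSpace X] [BorelSpace X]
    (ν : Measure X) [IsFiniteMeasure ν] (S : Set X) (hS : ν Sᶜ = 0) : measDim ν ≤ dimH S := by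
  refine ENNReal.le_of_forall_nnreal_lt fun s hs => ?_
  set F : ℕ → Set X := fun n => {x ∈ S | ∀ ρ : ℝ, 0 < ρ → ρ < 1 / (n + 1) →
    ν (ball x ρ) ≤ ENNReal.ofReal (1 * ρ ^ (s : ℝ))} with hF
  have hne : ν (⋃ n, F n) ≠ 0 := by
    intro h0
    refine absurd hs (not_lt.2 (essSup_le_of_ae_le _ ?_))
    have h1 : ∀ᵐ x ∂ν, x ∈ S := by rw [ae_iff]; exact hS
    have h2 : ∀ᵐ x ∂ν, x ∉ ⋃ n, F n := measure_eq_zero_iff_ae_notMem.1 h0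
    filter_upwards [h1, h2] with x hxS hx
    by_contra hlt
    rw [not_le] at hlt
    refine hx ?_
    have hev := eventually_lt_of_lt_liminf hlt
    have hev1 : ∀ᶠ ρ : ℝ in 𝓝[>] (0 : ℝ), ρ ∈ Ioo (0 : ℝ) 1 := Ioo_mem_nhdsGT one_pos
    obtain ⟨η, hη, hsub⟩ := mem_nhdsGT_iff_exists_Ioo_subset.1 (hev.and hev1)
    obtain ⟨n, hn⟩ := exists_nat_one_div_lt (show (0 : ℝ) < η from hη)
    refine mem_iUnion.2 ⟨n, hxS, fun ρ h0 h1 => ?_⟩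
    obtain ⟨h3, -, h4⟩ := hsub ⟨h0, h1.trans hn⟩
    have h5 : (s : ℝ) < Real.log (ν (ball x ρ)).toReal / Real.log ρ := by
      rw [← ENNReal.ofReal_coe_nnreal] at h3
      exact (ENNReal.ofReal_lt_ofReal_iff_of_nonneg s.coe_nonneg).1 h3
    rw [lt_div_iff_of_neg (Real.log_neg h0 h4)] at h5
    rw [← ENNReal.ofReal_toReal (measure_ne_top ν (ball x ρ)), one_mul]
    refine ENNReal.ofReal_le_ofReal ?_
    rcases (ENNReal.toReal_nonneg (a := ν (ball x ρ))).eq_or_lt with h6 | h6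
    · rw [← h6]; positivity
    · rw [← Real.log_le_log_iff h6 (by positivity), Real.log_rpow h0]
      exact h5.le
  obtain ⟨n, hn⟩ : ∃ n, ν (F n) ≠ 0 := by
    by_contra! hall
    exact hne (measure_iUnion_null hall)
  exact (le_dimH_of_measure_ball_le ν (F n) s 1 (1 / (n + 1)) one_pos (by positivity)
    (fun x hx => hx.2) hn).trans (dimH_mono fun x hx => hx.1)

/-- The set of points of the support where the lower pointwise dimension is at most `D` has
Hausdorff dimension at most `D`. -/
theorem dimH_lowerPtDim_le {X : Type*} [MetricSpace X] [MeasurableSpace X] [BorelSpace X]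
    (ν : Measure X) [IsFiniteMeasure ν] (D : ℝ≥0∞) :
    dimH {x | lowerPtDim ν x ≤ D ∧ ∀ ρ : ℝ, 0 < ρ → ν (ball x ρ) ≠ 0} ≤ D := by
  refine ENNReal.le_of_forall_pos_le_add fun ε hε hD => ?_
  lift D to ℝ≥0 using hD.ne
  rw [← ENNReal.coe_add]
  refine dimH_le_of_exists_le_measure_ball ν _ (D + ε) 1 one_pos fun x hx R hR => ?_
  have hlt : lowerPtDim ν x < ((D + ε : ℝ≥0) : ℝ≥0∞) :=
    hx.1.trans_lt (by exact_mod_cast lt_add_of_pos_right D hε)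
  have hfr := frequently_lt_of_liminf_lt (by isBoundedDefault) hlt
  have hev : ∀ᶠ ρ : ℝ in 𝓝[>] (0 : ℝ), ρ ∈ Ioo (0 : ℝ) (min R 1) :=
    Ioo_mem_nhdsGT (lt_min hR one_pos)
  obtain ⟨ρ, h1, h2⟩ := (hfr.and_eventually hev).exists
  refine ⟨ρ, h2.1, h2.2.trans_le (min_le_left _ _), ?_⟩
  have h4 : ρ < 1 := h2.2.trans_le (min_le_right _ _)
  have h5 : Real.log (ν (ball x ρ)).toReal / Real.log ρ < ((D + ε : ℝ≥0) : ℝ) := by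
    rw [← ENNReal.ofReal_coe_nnreal] at h1
    refine (ENNReal.ofReal_lt_ofReal_iff ?_).1 h1
    exact_mod_cast add_pos_of_nonneg_of_pos bot_le hε
  rw [div_lt_iff_of_neg (Real.log_neg h2.1 h4)] at h5
  have h6 : 0 < (ν (ball x ρ)).toReal := ENNReal.toReal_pos (hx.2 ρ h2.1) (measure_ne_top _ _)
  rw [one_mul, ← ENNReal.ofReal_toReal (measure_ne_top ν (ball x ρ))]
  refine ENNReal.ofReal_le_ofReal ?_
  rw [← Real.log_le_log_iff (Real.rpow_pos_of_pos h2.1 _) h6, Real.log_rpow h2.1]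
  exact h5.le

/-- If `ν` dominates a nonzero measure whose balls have mass at most `C * ρ ^ s`, then the
dimension of `ν` is at least `s`. -/
theorem le_measDim_of_measure_ball_le {X : Type*} [MetricSpace X] [SecondCountableTopology X]
    [MeasurableSpace X] [BorelSpace X]
    (ν m : Measure X) [IsFiniteMeasure ν] (hm : m ≤ ν) (hm0 : m ≠ 0) (s : ℝ≥0) (C ρ₀ : ℝ)
    (hC : 0 < C) (hρ₀ : 0 < ρ₀)
    (h : ∀ x, ∀ ρ, 0 < ρ → ρ < ρ₀ → m (ball x ρ) ≤ ENNReal.ofReal (C * ρ ^ (s : ℝ))) :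
    (s : ℝ≥0∞) ≤ measDim ν := by
  set T : Set X := {x | lowerPtDim ν x ≤ measDim ν ∧ ∀ ρ : ℝ, 0 < ρ → ν (ball x ρ) ≠ 0} with hT
  refine le_trans ?_ (dimH_lowerPtDim_le ν (measDim ν))
  have hsupp : ∀ᵐ x ∂ν, ∀ ρ : ℝ, 0 < ρ → ν (ball x ρ) ≠ 0 := by
    rw [ae_iff]
    refine measure_null_of_locally_null _ fun x hx => ?_
    simp only [not_forall, not_not, mem_ofPred_eq] at hx
    obtain ⟨ρ, hρ, h0⟩ := hx
    exact ⟨ball x ρ, mem_nhdsWithin_of_mem_nhds (ball_mem_nhds x hρ), h0⟩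
  have hνT : ν Tᶜ = 0 := by
    have : ∀ᵐ x ∂ν, x ∈ T := by
      filter_upwards [ae_le_essSup (μ := ν) (f := lowerPtDim ν), hsupp] with x h1 h2
      exact ⟨h1, h2⟩
    exact ae_iff.1 this
  refine le_dimH_of_measure_ball_le m T s C ρ₀ hC hρ₀ (fun x _ => h x) fun h0 => hm0 ?_
  rw [← Measure.measure_univ_eq_zero, ← union_compl_self T]
  exact measure_union_null h0 (le_antisymm ((hm _).trans hνT.le) bot_le)

/-- Let `W` be a finite sum of differences of translates of bounded measurable functions. Then
`W` cannot stay below a negative constant. -/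
theorem exists_neg_lt_sum_sub_translate {ι : Type*} (I : Finset ι) (a : ι → ℝ → ℝ)
    (c α β : ι → ℝ) (C : ℝ) (hm : ∀ j, Measurable (a j)) (hC : ∀ j u, |a j u| ≤ C)
    (ε : ℝ) (hε : 0 < ε) (u₀ : ℝ) :
    ∃ u, u₀ ≤ u ∧ -ε < ∑ j ∈ I, c j * (a j (u - α j) - a j (u - β j)) := by
  by_contra! hcon
  have hinteg : ∀ j x y, IntervalIntegrable (a j) volume x y := fun j x y => by
    rw [intervalIntegrable_iff]
    exact Measure.integrableOn_of_bounded (M := C) (by simp) (hm j).aestronglyMeasurable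
      (Eventually.of_forall fun u => by simpa using hC j u)
  have hbd : ∀ j x y, |∫ u in x..y, a j u| ≤ C * |y - x| := fun j x y => by
    simpa using intervalIntegral.norm_integral_le_of_norm_le_const
      (f := a j) (a := x) (b := y) (C := C) (fun u _ => by simpa using hC j u)
  set K := ∑ j ∈ I, |c j| * (2 * C * |β j - α j|) with hK
  have hlow : ∀ L, 0 ≤ L →
      -K ≤ ∫ u in u₀..(u₀ + L), ∑ j ∈ I, c j * (a j (u - α j) - a j (u - β j)) := by
    intro L hL
    have hi : ∀ j γ, IntervalIntegrable (fun u => a j (u - γ)) volume u₀ (u₀ + L) := fun j γ => by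
      have := (hinteg j (u₀ - γ) (u₀ + L - γ)).comp_sub_right γ
      simpa using this
    rw [intervalIntegral.integral_finsetSum fun j _ => ((hi j _).sub (hi j _)).const_mul _, hK,
      ← Finset.sum_neg_distrib]
    refine Finset.sum_le_sum fun j _ => ?_
    rw [intervalIntegral.integral_const_mul, intervalIntegral.integral_sub (hi j _) (hi j _),
      intervalIntegral.integral_comp_sub_right, intervalIntegral.integral_comp_sub_right]
    have e1 : (∫ u in (u₀ - α j)..(u₀ + L - α j), a j u) -
        ∫ u in (u₀ - β j)..(u₀ + L - β j), a j u =
        (∫ u in (u₀ - α j)..(u₀ - β j), a j u) -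
          ∫ u in (u₀ + L - α j)..(u₀ + L - β j), a j u := by
      rw [← intervalIntegral.integral_add_adjacent_intervals (hinteg j (u₀ - α j) (u₀ - β j))
          (hinteg j (u₀ - β j) (u₀ + L - α j)),
        ← intervalIntegral.integral_add_adjacent_intervals (hinteg j (u₀ - β j) (u₀ + L - α j))
          (hinteg j (u₀ + L - α j) (u₀ + L - β j))]
      ring
    rw [e1]
    have h1 := hbd j (u₀ - α j) (u₀ - β j)
    have h2 := hbd j (u₀ + L - α j) (u₀ + L - β j)
    have h3 : u₀ - β j - (u₀ - α j) = -(β j - α j) := by ring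
    have h4 : u₀ + L - β j - (u₀ + L - α j) = -(β j - α j) := by ring
    rw [h3, abs_neg] at h1
    rw [h4, abs_neg] at h2
    have h5 := (abs_sub (∫ u in (u₀ - α j)..(u₀ - β j), a j u)
      (∫ u in (u₀ + L - α j)..(u₀ + L - β j), a j u)).trans (add_le_add h1 h2)
    refine neg_le_of_abs_le ?_
    rw [abs_mul]
    refine mul_le_mul_of_nonneg_left (h5.trans (le_of_eq (by ring))) (abs_nonneg _)
  have hK0 : 0 ≤ K := by
    rcases I.eq_empty_or_nonempty with rfl | ⟨j, -⟩
    · simp [hK]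
    · have : 0 ≤ C := (abs_nonneg _).trans (hC j 0)
      rw [hK]; positivity
  set L := (K + 1) / ε with hLdef
  have hL : 0 ≤ L := by positivity
  have hup : ∫ u in u₀..(u₀ + L), ∑ j ∈ I, c j * (a j (u - α j) - a j (u - β j)) ≤
      ∫ u in u₀..(u₀ + L), -ε := by
    refine intervalIntegral.integral_mono_on (by linarith) ?_ (by simp) fun u hu => hcon u hu.1
    have hsum : IntervalIntegrable
        (∑ j ∈ I, fun u => c j * (a j (u - α j) - a j (u - β j))) volume u₀ (u₀ + L) := by
      refine IntervalIntegrable.sum I fun j _ => ?_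
      have hi : ∀ γ, IntervalIntegrable (fun u => a j (u - γ)) volume u₀ (u₀ + L) := fun γ => by
        have := (hinteg j (u₀ - γ) (u₀ + L - γ)).comp_sub_right γ
        simpa using this
      exact ((hi _).sub (hi _)).const_mul _
    rwa [Finset.sum_fn] at hsum
  have := (hlow L hL).trans hup
  rw [intervalIntegral.integral_const, smul_eq_mul] at this
  have h7 : L * ε = K + 1 := by rw [hLdef]; field_simp
  nlinarith

namespace DiagIFS

/-- The composition `φ_{i,w_0} ∘ ⋯ ∘ φ_{i,w_{n-1}}` in coordinate `i`. -/
noncomputable def prefixMap (Φ : DiagIFS d A) (i : Fin d) (w : ℕ → A i) (n : ℕ) (x : ℝ) : ℝ :=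
  (∏ k ∈ Finset.range n, Φ.slope i (w k)) * x +
    ∑ m ∈ Finset.range n, (∏ k ∈ Finset.range m, Φ.slope i (w k)) * Φ.off i (w m)

theorem prefixMap_succ (Φ : DiagIFS d A) (i : Fin d) (w : ℕ → A i) (n : ℕ) (x : ℝ) :
    Φ.prefixMap i w (n + 1) x = Φ.prefixMap i w n (Φ.base i (w n) x) := by
  simp only [prefixMap, base, Finset.prod_range_succ, Finset.sum_range_succ]
  ring

theorem prefixMap_congr (Φ : DiagIFS d A) (i : Fin d) (w w' : ℕ → A i) (n : ℕ)
    (h : ∀ k < n, w k = w' k) : Φ.prefixMap i w n = Φ.prefixMap i w' n := by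
  have hp : ∀ m ≤ n, ∏ k ∈ Finset.range m, Φ.slope i (w k) =
      ∏ k ∈ Finset.range m, Φ.slope i (w' k) := fun m hm =>
    Finset.prod_congr rfl fun k hk => by rw [h k ((Finset.mem_range.1 hk).trans_le hm)]
  funext x
  rw [prefixMap, prefixMap, hp n le_rfl]
  congr 1
  refine Finset.sum_congr rfl fun m hm => ?_
  have hm' := Finset.mem_range.1 hm
  rw [hp m hm'.le, h m hm']

theorem continuous_prefixMap (Φ : DiagIFS d A) (i : Fin d) (w : ℕ → A i) (n : ℕ) :
    Continuous (Φ.prefixMap i w n) := by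
  unfold prefixMap
  fun_prop

theorem base_mem_Ioo {Φ : DiagIFS d A} (hV : Φ.Valid) (i : Fin d) (a : A i) {x : ℝ}
    (hx : x ∈ Ioo (0 : ℝ) 1) : Φ.base i a x ∈ Ioo (0 : ℝ) 1 := by
  have h0 := hV.2.2.2 i a 0 (by simp)
  have h1 := hV.2.2.2 i a 1 (by simp)
  simp only [base, mem_Icc, mem_Ioo] at *
  rcases lt_or_gt_of_ne (hV.2.1 i a) with hs | hs
  · constructor <;> nlinarith
  · constructor <;> nlinarith

theorem image_prefixMap_antitone {Φ : DiagIFS d A} (i : Fin d) (w : ℕ → A i) (S : Set ℝ)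
    (hS : ∀ a : A i, ∀ x ∈ S, Φ.base i a x ∈ S) :
    Antitone fun n => Φ.prefixMap i w n '' S := by
  refine antitone_nat_of_succ_le fun n => ?_
  rintro _ ⟨x, hx, rfl⟩
  exact ⟨Φ.base i (w n) x, hS _ x hx, (Φ.prefixMap_succ i w n x).symm⟩

theorem Valid.exists_slope_le {Φ : DiagIFS d A} (hV : Φ.Valid) :
    ∃ q : ℝ, 0 ≤ q ∧ q < 1 ∧ ∀ i a, |Φ.slope i a| ≤ q := by
  rcases isEmpty_or_nonempty (Σ i, A i) with he | hne
  · exact ⟨0, le_rfl, one_pos, fun i a => (he.false ⟨i, a⟩).elim⟩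
  · obtain ⟨z, hz⟩ := Finite.exists_max fun z : Σ i, A i => |Φ.slope z.1 z.2|
    exact ⟨|Φ.slope z.1 z.2|, abs_nonneg _, hV.2.2.1 _ _, fun i a => hz ⟨i, a⟩⟩

theorem Valid.exists_coding_term_le {Φ : DiagIFS d A} (hV : Φ.Valid) :
    ∃ q : ℝ, 0 ≤ q ∧ q < 1 ∧ ∀ (i : Fin d) (w : ℕ → A i) (n : ℕ),
      ‖(∏ k ∈ Finset.range n, Φ.slope i (w k)) * Φ.off i (w n)‖ ≤ q ^ n := by
  obtain ⟨q, hq0, hq1, hq⟩ := hV.exists_slope_le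
  refine ⟨q, hq0, hq1, fun i w n => ?_⟩
  have h0 := hV.2.2.2 i (w n) 0 (by simp)
  simp only [base, mul_zero, zero_add, mem_Icc] at h0
  rw [norm_mul, Real.norm_eq_abs, Real.norm_eq_abs, Finset.abs_prod, abs_of_nonneg h0.1]
  calc _ ≤ (∏ k ∈ Finset.range n, q) * 1 := by
        refine mul_le_mul (Finset.prod_le_prod (fun _ _ => abs_nonneg _) fun k _ => hq i _) h0.2
          h0.1 (Finset.prod_nonneg fun _ _ => hq0)
    _ = q ^ n := by simp

instance (Φ : DiagIFS d A) : DiscreteTopology Φ.Symb := ⟨rfl⟩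

theorem Valid.continuous_coding {Φ : DiagIFS d A} (hV : Φ.Valid) : Continuous Φ.coding := by
  obtain ⟨q, hq0, hq1, hq⟩ := hV.exists_coding_term_le
  refine continuous_pi fun i => ?_
  refine continuous_tsum (u := fun n => q ^ n) (fun n => ?_)
    (summable_geometric_of_lt_one hq0 hq1) fun n ω => hq i (fun k => (ω k).1 i) n
  refine Continuous.mul (continuous_finsetProd _ fun k _ => ?_) ?_
  · exact (continuous_of_discreteTopology (f := fun a : Φ.Symb => Φ.slope i (a.1 i))).comp
      (continuous_apply k)
  · exact (continuous_of_discreteTopology (f := fun a : Φ.Symb => Φ.off i (a.1 i))).comp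
      (continuous_apply n)

theorem Valid.measurable_coding {Φ : DiagIFS d A} (hV : Φ.Valid) : Measurable Φ.coding :=
  hV.continuous_coding.measurable

theorem Valid.isCompact_limitSet {Φ : DiagIFS d A} (hV : Φ.Valid) : IsCompact Φ.limitSet :=
  isCompact_range hV.continuous_coding

theorem Valid.coding_mem_image_prefixMap {Φ : DiagIFS d A} (hV : Φ.Valid) (ω : ℕ → Φ.Symb)
    (i : Fin d) (n : ℕ) :
    Φ.coding ω i ∈ Φ.prefixMap i (fun k => (ω k).1 i) n '' Icc 0 1 := by
  obtain ⟨q, hq0, hq1, hq⟩ := hV.exists_coding_term_le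
  have hsum : Summable fun n : ℕ =>
      (∏ k ∈ Finset.range n, Φ.slope i ((ω k).1 i)) * Φ.off i ((ω n).1 i) :=
    Summable.of_norm_bounded (summable_geometric_of_lt_one hq0 hq1)
      fun n => hq i (fun k => (ω k).1 i) n
  have hclosed : IsClosed (Φ.prefixMap i (fun k => (ω k).1 i) n '' Icc 0 1) :=
    (isCompact_Icc.image (Φ.continuous_prefixMap i _ n)).isClosed
  refine hclosed.mem_of_tendsto hsum.hasSum.tendsto_sum_nat
    (eventually_atTop.2 ⟨n, fun m hm => ?_⟩)
  refine image_prefixMap_antitone i (fun k => (ω k).1 i) (Icc 0 1) (hV.2.2.2 i) hm ?_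
  exact ⟨0, by simp, by simp [prefixMap]⟩

/-- The approximate square of size `exp (-t)` around `ω`: coordinate `i`, contracted at rate
`χ i`, is prescribed up to time `⌊t / χ i⌋`. -/
def cell (Φ : DiagIFS d A) (χ : Fin d → ℝ) (t : ℝ) (ω : ℕ → Φ.Symb) : Set (ℕ → Φ.Symb) :=
  {ω' | ∀ i, ∀ k < ⌊t / χ i⌋₊, (ω' k).1 i = (ω k).1 i}

theorem exists_finite_cell_cover (Φ : DiagIFS d A) (χ : Fin d → ℝ) (t : ℝ)
    (S : Set (ℕ → Φ.Symb)) :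
    ∃ W : Finset (ℕ → Φ.Symb), ↑W ⊆ S ∧ S ⊆ ⋃ ω ∈ W, Φ.cell χ t ω ∧
      ∀ ω ∈ W, ∀ ω' ∈ W, ω' ∈ Φ.cell χ t ω → ω = ω' := by
  let key : (ℕ → Φ.Symb) → ∀ i : Fin d, Fin ⌊t / χ i⌋₊ → A i := fun ω i k => (ω k).1 i
  obtain ⟨W, hWS, hW⟩ := exists_subset_bijOn S key
  have hfin : W.Finite := (toFinite (key '' W)).of_finite_image hW.injOn
  have hcell : ∀ ω ω', ω' ∈ Φ.cell χ t ω ↔ key ω' = key ω := by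
    intro ω ω'
    constructor
    · intro h
      funext i k
      exact h i k k.2
    · intro h i k hk
      exact congrFun (congrFun h i) ⟨k, hk⟩
  refine ⟨hfin.toFinset, by simpa using hWS, fun ω hω => ?_, fun ω hω ω' hω' h => ?_⟩
  · obtain ⟨ω', hω', he⟩ := hW.surjOn (mem_image_of_mem key hω)
    simp only [mem_iUnion]
    exact ⟨ω', by simpa using hω', (hcell _ _).2 he.symm⟩
  · exact hW.injOn (by simpa using hω) (by simpa using hω') ((hcell _ _).1 h).symm

section ConstRatio

variable {Φ : DiagIFS d A} {χ : Fin d → ℝ}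

theorem abs_prod_slope (hχ : ∀ i a, |Φ.slope i a| = Real.exp (-χ i)) (i : Fin d)
    (w : ℕ → A i) (n : ℕ) :
    |∏ k ∈ Finset.range n, Φ.slope i (w k)| = Real.exp (-(n * χ i)) := by
  rw [Finset.abs_prod, Finset.prod_congr rfl fun k _ => hχ i (w k), Finset.prod_const,
    Finset.card_range, ← Real.exp_nat_mul]
  congr 1; ring

theorem exp_neg_floor_mul_mem (hχ0 : ∀ i, 0 < χ i) (t : ℝ) (ht : 0 ≤ t) (i : Fin d) :
    Real.exp (-t) ≤ Real.exp (-(⌊t / χ i⌋₊ * χ i)) ∧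
      Real.exp (-(⌊t / χ i⌋₊ * χ i)) ≤ Real.exp (χ i) * Real.exp (-t) := by
  have h1 := Nat.floor_le (div_nonneg ht (hχ0 i).le)
  have h2 := Nat.lt_floor_add_one (t / χ i)
  rw [le_div_iff₀ (hχ0 i)] at h1
  rw [div_lt_iff₀ (hχ0 i)] at h2
  rw [← Real.exp_add, Real.exp_le_exp, Real.exp_le_exp]
  constructor <;> linarith

theorem abs_sub_le_of_mem_image_prefixMap (hχ : ∀ i a, |Φ.slope i a| = Real.exp (-χ i))
    (i : Fin d) (w : ℕ → A i) (n : ℕ) {x y : ℝ} (hx : x ∈ Φ.prefixMap i w n '' Icc 0 1)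
    (hy : y ∈ Φ.prefixMap i w n '' Icc 0 1) : |x - y| ≤ Real.exp (-(n * χ i)) := by
  obtain ⟨u, hu, rfl⟩ := hx
  obtain ⟨v, hv, rfl⟩ := hy
  have : Φ.prefixMap i w n u - Φ.prefixMap i w n v =
      (∏ k ∈ Finset.range n, Φ.slope i (w k)) * (u - v) := by
    simp only [prefixMap]; ring
  rw [this, abs_mul, abs_prod_slope hχ]
  refine mul_le_of_le_one_right (Real.exp_pos _).le ?_
  rw [abs_le]
  constructor <;> linarith [hu.1, hu.2, hv.1, hv.2]

theorem dist_coding_le_of_mem_cell (hV : Φ.Valid) (hχ : ∀ i a, |Φ.slope i a| = Real.exp (-χ i))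
    (hχ0 : ∀ i, 0 < χ i) {K : ℝ} (hK0 : 0 ≤ K) (hK : ∀ i, Real.exp (χ i) ≤ K) {t : ℝ} (ht : 0 ≤ t)
    {ω ω' : ℕ → Φ.Symb} (h : ω' ∈ Φ.cell χ t ω) :
    dist (Φ.coding ω') (Φ.coding ω) ≤ K * Real.exp (-t) := by
  rw [dist_pi_le_iff (by positivity)]
  intro i
  have h1 := hV.coding_mem_image_prefixMap ω' i ⌊t / χ i⌋₊
  have h2 := hV.coding_mem_image_prefixMap ω i ⌊t / χ i⌋₊
  rw [Φ.prefixMap_congr i _ (fun k => (ω k).1 i) _ (h i)] at h1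
  rw [Real.dist_eq]
  refine (abs_sub_le_of_mem_image_prefixMap hχ i _ _ h1 h2).trans
    ((exp_neg_floor_mul_mem hχ0 t ht i).2.trans ?_)
  gcongr
  exact hK i

theorem disjoint_image_prefixMap (hV : Φ.Valid) (hχ0 : ∀ i, 0 < χ i)
    (hgood : ∀ x > 0, Φ.GoodIdx (Finset.univ.filter fun i => χ i ≤ x)) {t : ℝ} (ht : 0 ≤ t)
    {ω ω' : ℕ → Φ.Symb} (h : ω' ∉ Φ.cell χ t ω) :
    ∃ i, Disjoint (Φ.prefixMap i (fun k => (ω k).1 i) ⌊t / χ i⌋₊ '' Ioo 0 1)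
      (Φ.prefixMap i (fun k => (ω' k).1 i) ⌊t / χ i⌋₊ '' Ioo 0 1) := by
  have hex : ∃ k, ∃ i, k < ⌊t / χ i⌋₊ ∧ (ω' k).1 i ≠ (ω k).1 i := by
    simp only [cell, mem_ofPred_eq, not_forall] at h
    obtain ⟨i, k, hk, hne⟩ := h
    exact ⟨k, i, hk, hne⟩
  set k := Nat.find hex with hkdef
  obtain ⟨i₀, hi₀, hne₀⟩ := Nat.find_spec hex
  rw [← hkdef] at hi₀ hne₀
  have hmin : ∀ l < k, ∀ i, l < ⌊t / χ i⌋₊ → (ω' l).1 i = (ω l).1 i := by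
    intro l hl i hi
    have := Nat.find_min hex hl
    push Not at this
    exact this i hi
  have hiff : ∀ i, k < ⌊t / χ i⌋₊ ↔ χ i ≤ t / ((k : ℝ) + 1) := by
    intro i
    rw [Nat.lt_iff_add_one_le, Nat.le_floor_iff (div_nonneg ht (hχ0 i).le), le_div_iff₀ (hχ0 i),
      le_div_iff₀ (by positivity)]
    push_cast
    rw [mul_comm]
  have hx : 0 < t / ((k : ℝ) + 1) := (hχ0 i₀).trans_le ((hiff i₀).1 hi₀)
  obtain ⟨i, hi, hdis⟩ := hgood _ hx (ω k).1 (ω k).2 (ω' k).1 (ω' k).2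
    ⟨i₀, by simpa using (hiff i₀).1 hi₀, hne₀.symm⟩
  have hki : k < ⌊t / χ i⌋₊ := (hiff i).2 (by simpa using hi)
  refine ⟨i, ?_⟩
  have hinj : Function.Injective (Φ.prefixMap i (fun k => (ω k).1 i) k) := by
    intro x y hxy
    have hp : ∏ l ∈ Finset.range k, Φ.slope i ((ω l).1 i) ≠ 0 :=
      Finset.prod_ne_zero_iff.2 fun l _ => hV.2.1 i _
    simp only [prefixMap, add_left_inj] at hxy
    exact mul_left_cancel₀ hp hxy
  have hsub : ∀ v : ℕ → Φ.Symb, Φ.prefixMap i (fun k => (v k).1 i) ⌊t / χ i⌋₊ '' Ioo 0 1 ⊆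
      Φ.prefixMap i (fun k => (v k).1 i) k '' (Φ.base i ((v k).1 i) '' Ioo 0 1) := by
    intro v
    refine (image_prefixMap_antitone i _ (Ioo 0 1) (fun a x hx => base_mem_Ioo hV i a hx)
      (show k + 1 ≤ _ from hki)).trans ?_
    rintro _ ⟨x, hx, rfl⟩
    exact ⟨_, ⟨x, hx, rfl⟩, (Φ.prefixMap_succ i _ k x).symm⟩
  have h2 := hsub ω'
  rw [Φ.prefixMap_congr i (fun k => (ω' k).1 i) (fun k => (ω k).1 i) k
    (fun l hl => hmin l hl i (hl.trans hki))] at h2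
  exact ((disjoint_image_iff hinj).2 hdis).mono (hsub ω) h2

open scoped Pointwise in
theorem volume_image_prefixMap (hχ : ∀ i a, |Φ.slope i a| = Real.exp (-χ i)) (i : Fin d)
    (w : ℕ → A i) (n : ℕ) :
    volume (Φ.prefixMap i w n '' Ioo 0 1) = ENNReal.ofReal (Real.exp (-(n * χ i))) := by
  have : Φ.prefixMap i w n '' Ioo 0 1 =
      (fun x => x + ∑ m ∈ Finset.range n,
        (∏ k ∈ Finset.range m, Φ.slope i (w k)) * Φ.off i (w m)) ''
        ((∏ k ∈ Finset.range n, Φ.slope i (w k)) • Ioo (0 : ℝ) 1) := by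
    rw [← image_smul, image_image]
    rfl
  rw [this, image_add_right, measure_preimage_add_right, Measure.addHaar_smul]
  simp [abs_prod_slope hχ]

theorem isOpen_image_prefixMap (hV : Φ.Valid) (i : Fin d) (w : ℕ → A i) (n : ℕ) :
    IsOpen (Φ.prefixMap i w n '' Ioo 0 1) := by
  have hp : ∏ l ∈ Finset.range n, Φ.slope i (w l) ≠ 0 :=
    Finset.prod_ne_zero_iff.2 fun l _ => hV.2.1 i _
  exact ((Homeomorph.mulLeft₀ _ hp).trans (Homeomorph.addRight _)).isOpenMap _ isOpen_Ioo

/-- A ball of radius `exp (-t)` meets boundedly many approximate squares of size `exp (-t)`. -/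
theorem card_le_of_pairwise_not_mem_cell (hV : Φ.Valid)
    (hχ : ∀ i a, |Φ.slope i a| = Real.exp (-χ i)) (hχ0 : ∀ i, 0 < χ i)
    (hgood : ∀ x > 0, Φ.GoodIdx (Finset.univ.filter fun i => χ i ≤ x))
    {K : ℝ} (hK0 : 0 ≤ K) (hK : ∀ i, Real.exp (χ i) ≤ K) {t : ℝ} (ht : 0 ≤ t)
    (x : Fin d → ℝ) (W : Finset (ℕ → Φ.Symb))
    (hWx : ∀ ω ∈ W, Φ.coding ω ∈ ball x (Real.exp (-t)))
    (hW : ∀ ω ∈ W, ∀ ω' ∈ W, ω' ∈ Φ.cell χ t ω → ω = ω') :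
    (W.card : ℝ) ≤ (2 * (K + 1)) ^ d := by
  set ρ := Real.exp (-t) with hρ
  have hρ0 : 0 < ρ := Real.exp_pos _
  set box : (ℕ → Φ.Symb) → Set (Fin d → ℝ) := fun ω =>
    Set.pi univ fun i => Φ.prefixMap i (fun k => (ω k).1 i) ⌊t / χ i⌋₊ '' Ioo 0 1 with hbox
  have hdisj : (W : Set (ℕ → Φ.Symb)).PairwiseDisjoint box := by
    intro ω hω ω' hω' hne
    obtain ⟨i, hi⟩ := disjoint_image_prefixMap hV hχ0 hgood ht
      (fun h => hne (hW ω hω ω' hω' h))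
    exact Set.disjoint_univ_pi.2 ⟨i, hi⟩
  have hmeas : ∀ ω ∈ W, MeasurableSet (box ω) := fun ω _ =>
    MeasurableSet.univ_pi fun i => (isOpen_image_prefixMap hV i _ _).measurableSet
  have hvol : ∀ ω ∈ W, ENNReal.ofReal (ρ ^ d) ≤ volume (box ω) := by
    intro ω _
    rw [hbox, volume_pi_pi, Finset.prod_congr rfl fun i _ => volume_image_prefixMap hχ i _ _]
    calc ENNReal.ofReal (ρ ^ d) = ∏ i : Fin d, ENNReal.ofReal ρ := by
          rw [Finset.prod_const, Finset.card_univ, Fintype.card_fin, ENNReal.ofReal_pow hρ0.le]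
      _ ≤ _ := by
        refine Finset.prod_le_prod' fun i _ => ENNReal.ofReal_le_ofReal ?_
        exact (exp_neg_floor_mul_mem hχ0 t ht i).1
  have hsub : (⋃ ω ∈ W, box ω) ⊆ closedBall x ((K + 1) * ρ) := by
    refine iUnion₂_subset fun ω hω y hy => ?_
    rw [mem_closedBall, dist_pi_le_iff (by positivity)]
    intro i
    have h1 : y i ∈ Φ.prefixMap i (fun k => (ω k).1 i) ⌊t / χ i⌋₊ '' Icc 0 1 :=
      image_mono Ioo_subset_Icc_self (hy i (mem_univ i))
    have h2 := abs_sub_le_of_mem_image_prefixMap hχ i _ _ h1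
      (hV.coding_mem_image_prefixMap ω i ⌊t / χ i⌋₊)
    have h3 := (exp_neg_floor_mul_mem hχ0 t ht i).2
    have h4 : Real.exp (χ i) * ρ ≤ K * ρ := by gcongr; exact hK i
    have h5 : dist (Φ.coding ω i) (x i) < ρ :=
      (dist_le_pi_dist _ _ i).trans_lt (mem_ball.1 (hWx ω hω))
    calc dist (y i) (x i) ≤ dist (y i) (Φ.coding ω i) + dist (Φ.coding ω i) (x i) :=
          dist_triangle _ _ _
      _ ≤ K * ρ + ρ := add_le_add (by rw [Real.dist_eq]; linarith) h5.le
      _ = (K + 1) * ρ := by ring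
  have hfin : (W.card : ℝ≥0∞) * ENNReal.ofReal (ρ ^ d) ≤
      ENNReal.ofReal ((2 * ((K + 1) * ρ)) ^ d) := by
    calc (W.card : ℝ≥0∞) * ENNReal.ofReal (ρ ^ d) = ∑ ω ∈ W, ENNReal.ofReal (ρ ^ d) := by
          rw [Finset.sum_const, nsmul_eq_mul]
      _ ≤ ∑ ω ∈ W, volume (box ω) := Finset.sum_le_sum hvol
      _ = volume (⋃ ω ∈ W, box ω) := (measure_biUnion_finset hdisj hmeas).symm
      _ ≤ volume (closedBall x ((K + 1) * ρ)) := measure_mono hsub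
      _ = _ := by rw [Real.volume_pi_closedBall x (by positivity), Fintype.card_fin]
  rw [← ENNReal.ofReal_natCast, ← ENNReal.ofReal_mul (by positivity),
    ENNReal.ofReal_le_ofReal_iff (by positivity), ← mul_assoc, mul_pow _ ρ] at hfin
  exact le_of_mul_le_mul_right hfin (by positivity)

end ConstRatio

end DiagIFS

/-- McMullen's construction: given a decreasing sequence of equivalence relations and exponents
`s`, there is a positive weight whose class masses have prescribed conditional structure. -/
theorem exists_weight_log_mass {S : Type*} [Fintype S] (R : ℕ → S → S → Prop)
    (hR : ∀ j, Equivalence (R j)) (hanti : ∀ j a b, R (j + 1) a b → R j a b) (s : ℕ → ℝ) (n : ℕ)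
    (V : S → ℝ) (hV : ∀ a, 0 < V a) :
    ∃ (h : S → ℝ) (f : ℕ → S → ℝ), (∀ a, 0 < h a) ∧ (∀ a b, R n a b → h a = h b) ∧
      (∀ a, ∑ b with R 0 b a, V b * h b = 1) ∧ (∀ a b, R 0 a b → f 0 a = f 0 b) ∧
      (∀ a, f n a = Real.log (∑ b with R n b a, V b)) ∧
      ∀ j < n, ∀ a, Real.log (∑ b with R (j + 1) b a, V b * h b) =
        Real.log (∑ b with R j b a, V b * h b) + (s (j + 1) * f (j + 1) a - f j a) := by
  have hpos : ∀ (W : S → ℝ), (∀ a, 0 < W a) → ∀ j a, 0 < ∑ b with R j b a, W b := fun W hW j a =>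
    Finset.sum_pos (fun b _ => hW b) ⟨a, by simpa using (hR j).refl a⟩
  have hclass : ∀ j a b, R j a b → (Finset.univ.filter fun c => R j c a) =
      Finset.univ.filter fun c => R j c b := fun j a b hab =>
    Finset.filter_congr fun c _ =>
      ⟨fun h => (hR j).trans h hab, fun h => (hR j).trans h ((hR j).symm hab)⟩
  induction n generalizing V with
  | zero =>
    refine ⟨fun a => (∑ b with R 0 b a, V b)⁻¹, fun _ a => Real.log (∑ b with R 0 b a, V b),
      fun a => inv_pos.2 (hpos V hV 0 a), fun a b hab => ?_, fun a => ?_, fun a b hab => ?_,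
      fun a => rfl, fun j hj => absurd hj (Nat.not_lt_zero j)⟩
    · simp only [hclass 0 a b hab]
    · have : ∀ b ∈ Finset.univ.filter (fun b => R 0 b a), V b * (∑ c with R 0 c b, V c)⁻¹ =
          V b * (∑ c with R 0 c a, V c)⁻¹ := fun b hb => by
        rw [hclass 0 b a (by simpa using hb)]
      rw [Finset.sum_congr rfl this, ← Finset.sum_mul, mul_inv_cancel₀ (hpos V hV 0 a).ne']
    · simp only [hclass 0 a b hab]
  | succ n ih =>
    set Z : S → ℝ := fun a => ∑ b with R (n + 1) b a, V b with hZ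
    have hZ0 : ∀ a, 0 < Z a := hpos V hV (n + 1)
    have hZc : ∀ a b, R (n + 1) a b → Z a = Z b := fun a b hab => by
      simp only [hZ, hclass _ a b hab]
    obtain ⟨h, f, h0, hc, hone, hf0, hfn, hrec⟩ := ih (fun a => V a * Z a ^ (s (n + 1) - 1))
      fun a => mul_pos (hV a) (Real.rpow_pos_of_pos (hZ0 a) _)
    simp only [mul_assoc] at hone hrec
    refine ⟨fun a => Z a ^ (s (n + 1) - 1) * h a,
      fun j a => if j = n + 1 then Real.log (Z a) else f j a,
      fun a => mul_pos (Real.rpow_pos_of_pos (hZ0 a) _) (h0 a), fun a b hab => ?_, hone, ?_,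
      fun a => by simp [hZ], fun j hj a => ?_⟩
    · simp only [hZc a b hab, hc a b (hanti n a b hab)]
    · simpa using hf0
    · rcases (Nat.lt_succ_iff_lt_or_eq.1 hj) with hj | rfl
      · beta_reduce
        rw [hrec j hj a, if_neg (by omega), if_neg (by omega)]
      · have e1 : ∑ b with R (j + 1) b a, V b * (Z b ^ (s (j + 1) - 1) * h b) =
            Z a * (Z a ^ (s (j + 1) - 1) * h a) := by
          rw [show Z a * (Z a ^ (s (j + 1) - 1) * h a) =
            ∑ b with R (j + 1) b a, V b * (Z a ^ (s (j + 1) - 1) * h a) by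
              rw [← Finset.sum_mul]]
          refine Finset.sum_congr rfl fun b hb => ?_
          have hb : R (j + 1) b a := by simpa using hb
          rw [hZc b a hb, hc b a (hanti j b a hb)]
        have e2 : ∑ b with R j b a, V b * (Z b ^ (s (j + 1) - 1) * h b) =
            (∑ b with R j b a, V b * Z b ^ (s (j + 1) - 1)) * h a := by
          rw [Finset.sum_mul]
          refine Finset.sum_congr rfl fun b hb => ?_
          rw [hc b a (by simpa using hb), mul_assoc]
        have hz := hpos _ (fun b => mul_pos (hV b) (Real.rpow_pos_of_pos (hZ0 b)
          (s (j + 1) - 1))) j a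
        beta_reduce
        rw [e1, e2, Real.log_mul hz.ne' (h0 a).ne', ← hfn a, Real.log_mul (hZ0 a).ne'
          (mul_pos (Real.rpow_pos_of_pos (hZ0 a) _) (h0 a)).ne', Real.log_mul
          (Real.rpow_pos_of_pos (hZ0 a) _).ne' (h0 a).ne', Real.log_rpow (hZ0 a), if_pos rfl,
          if_neg (by omega)]
        ring

theorem exists_rank (χ : Fin d → ℝ) (hχ0 : ∀ i, 0 < χ i) :
    ∃ (rk : Fin d → ℕ) (c : ℕ → ℝ), (∀ i, rk i < d) ∧ (∀ i, χ i = c (rk i)) ∧ (∀ j, 0 < c j) ∧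
      ∀ j l, j ≤ l → l < d → c j ≤ c l := by
  refine ⟨fun i => ((Tuple.sort χ).symm i : ℕ),
    fun j => if h : j < d then χ (Tuple.sort χ ⟨j, h⟩) else 1, fun i => Fin.isLt _, fun i => ?_,
    fun j => ?_, fun j l hjl hl => ?_⟩
  · simp
  · beta_reduce
    split_ifs
    · exact hχ0 _
    · exact one_pos
  · beta_reduce
    rw [dif_pos hl, dif_pos (hjl.trans_lt hl)]
    exact Tuple.monotone_sort χ (show (⟨j, _⟩ : Fin d) ≤ ⟨l, hl⟩ from hjl)

theorem exists_iff_lt_of_antitone (n : ℕ) (P : ℕ → Prop) (hP : ∀ j l, j ≤ l → l < n → P l → P j) :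
    ∃ m ≤ n, ∀ j < n, j < m ↔ P j := by
  have hex : ∃ m, m < n → ¬P m := ⟨n, fun h => absurd h (lt_irrefl n)⟩
  refine ⟨Nat.find hex, Nat.find_min' hex fun h => absurd h (lt_irrefl n), fun j hj => ⟨fun h => ?_,
    fun h => ?_⟩⟩
  · have := Nat.find_min hex h
    push Not at this
    exact this.2
  · by_contra hlt
    push Not at hlt
    exact Nat.find_spec hex (hlt.trans_lt hj) (hP _ _ hlt hj h)

namespace DiagIFS

/-- The measure on the alphabet with density `p`. -/
noncomputable def symbMeasure (Φ : DiagIFS d A) (p : Φ.Symb → ℝ) : Measure Φ.Symb :=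
  ∑ a, ENNReal.ofReal (p a) • Measure.dirac a

theorem symbMeasure_apply (Φ : DiagIFS d A) {p : Φ.Symb → ℝ} (hp : ∀ a, 0 ≤ p a)
    (s : Set Φ.Symb) : Φ.symbMeasure p s = ENNReal.ofReal (∑ a with a ∈ s, p a) := by
  rw [symbMeasure, Measure.finsetSum_apply, ENNReal.ofReal_sum_of_nonneg fun a _ => hp a,
    Finset.sum_filter]
  refine Finset.sum_congr rfl fun a _ => ?_
  rw [Measure.smul_apply, Measure.dirac_apply' _ (MeasurableSpace.measurableSet_top)]
  by_cases h : a ∈ s <;> simp [h]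

/-- Agreement of two symbols in all coordinates of rank less than `j`. -/
def Agree (Φ : DiagIFS d A) (rk : Fin d → ℕ) (j : ℕ) (a b : Φ.Symb) : Prop :=
  ∀ i, rk i < j → a.1 i = b.1 i

theorem log_measure_cell (Φ : DiagIFS d A) {χ : Fin d → ℝ} {rk : Fin d → ℕ} {c : ℕ → ℝ}
    (hrk : ∀ i, rk i < d) (hχ : ∀ i, χ i = c (rk i)) (hc0 : ∀ j, 0 < c j)
    (hc : ∀ j l, j ≤ l → l < d → c j ≤ c l) {p : Φ.Symb → ℝ} (hp : ∀ a, 0 < p a)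
    (hone : ∀ a, ∑ b with Φ.Agree rk 0 b a, p b = 1) {g : ℕ → Φ.Symb → ℝ}
    (hrec : ∀ j < d, ∀ a, Real.log (∑ b with Φ.Agree rk (j + 1) b a, p b) =
      Real.log (∑ b with Φ.Agree rk j b a, p b) + g j a)
    [IsProbabilityMeasure (Φ.symbMeasure p)] {t : ℝ} (ht : 0 ≤ t) (ω : ℕ → Φ.Symb) :
    Measure.infinitePi (fun _ : ℕ => Φ.symbMeasure p) (Φ.cell χ t ω) =
      ENNReal.ofReal (Real.exp
        (∑ j ∈ Finset.range d, ∑ k ∈ Finset.range ⌊t / c j⌋₊, g j (ω k))) := by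
  have hJ : ∀ k : ℕ, ∃ m ≤ d, ∀ j < d, j < m ↔ k < ⌊t / c j⌋₊ := fun k =>
    exists_iff_lt_of_antitone d (fun j => k < ⌊t / c j⌋₊) fun j l hjl hl h =>
      h.trans_le (Nat.floor_le_floor (div_le_div_of_nonneg_left ht (hc0 j) (hc j l hjl hl)))
  choose J hJd hJ using hJ
  set N := ∑ j ∈ Finset.range d, ⌊t / c j⌋₊ with hN
  have hjN : ∀ j < d, ⌊t / c j⌋₊ ≤ N := fun j hj =>
    Finset.single_le_sum (f := fun j => ⌊t / c j⌋₊) (fun _ _ => Nat.zero_le _)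
      (Finset.mem_range.2 hj)
  have hmass : ∀ j a, 0 < ∑ b with Φ.Agree rk j b a, p b := fun j a =>
    Finset.sum_pos (fun b _ => hp b) ⟨a, Finset.mem_filter.2 ⟨Finset.mem_univ a, fun _ _ => rfl⟩⟩
  have hlog : ∀ m ≤ d, ∀ a, Real.log (∑ b with Φ.Agree rk m b a, p b) =
      ∑ j ∈ Finset.range m, g j a := by
    intro m
    induction m with
    | zero => intro _ a; rw [hone a, Real.log_one, Finset.sum_range_zero]
    | succ m ih => intro hm a; rw [hrec m hm, ih (by omega), Finset.sum_range_succ]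
  have hcell : Φ.cell χ t ω =
      Set.pi (Finset.range N : Set ℕ) fun k => {a | Φ.Agree rk (J k) a (ω k)} := by
    ext ω'
    simp only [cell, Agree, mem_ofPred_eq, Set.mem_pi, Finset.coe_range, mem_Iio]
    constructor
    · intro h k _ i hi
      exact h i k (by rw [hχ]; exact (hJ k _ (hrk i)).1 hi)
    · intro h i k hk
      rw [hχ] at hk
      exact h k (hk.trans_le (hjN _ (hrk i))) i ((hJ k _ (hrk i)).2 hk)
  rw [hcell, Measure.infinitePi_pi _ fun _ _ => MeasurableSpace.measurableSet_top]
  have hterm : ∀ k ∈ Finset.range N, Φ.symbMeasure p {a | Φ.Agree rk (J k) a (ω k)} =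
      ENNReal.ofReal (Real.exp (∑ j ∈ Finset.range (J k), g j (ω k))) := fun k _ => by
    rw [Φ.symbMeasure_apply fun a => (hp a).le, ← hlog _ (hJd k), Real.exp_log (hmass _ _)]
    rfl
  rw [Finset.prod_congr rfl hterm, ← ENNReal.ofReal_prod_of_nonneg fun _ _ => (Real.exp_pos _).le,
    ← Real.exp_sum]
  congr 2
  refine Finset.sum_comm' fun k j => ?_
  simp only [Finset.mem_range]
  constructor
  · rintro ⟨_, h⟩
    have hj := h.trans_le (hJd k)
    exact ⟨(hJ k j hj).1 h, hj⟩
  · rintro ⟨h, hj⟩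
    exact ⟨h.trans_le (hjN j hj), (hJ k j hj).2 h⟩

/-- The averages `x⁻¹ ∑_{k < x} f (ω k)` along real times. -/
noncomputable def avg (Φ : DiagIFS d A) (f : Φ.Symb → ℝ) (ω : ℕ → Φ.Symb) (x : ℝ) : ℝ :=
  (∑ k ∈ Finset.range ⌊x⌋₊, f (ω k)) / x

/-- The McMullen measure: the logarithmic mass of approximate squares is a linear term, plus
differences of averages at comparable times, plus a bounded error. -/
theorem exists_measure_cell_eq {m : ℕ} {A : Fin (m + 1) → Type} [∀ i, Fintype (A i)]
    (Φ : DiagIFS (m + 1) A) (hE : Φ.E.Nonempty) {χ : Fin (m + 1) → ℝ} (hχ0 : ∀ i, 0 < χ i) :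
    ∃ (P : Measure Φ.Symb) (_ : IsProbabilityMeasure P) (f : ℕ → Φ.Symb → ℝ) (c : ℕ → ℝ)
      (δ C : ℝ) (e : ℝ → ℝ), (∀ j, 0 < c j) ∧ (∀ t, |e t| ≤ C) ∧ ∀ t > 0, ∀ ω,
      Measure.infinitePi (fun _ : ℕ => P) (Φ.cell χ t ω) = ENNReal.ofReal (Real.exp
        (t * (-δ + ∑ j ∈ Finset.range m, (c (j + 1))⁻¹ *
          (Φ.avg (f j) ω (t / c j) - Φ.avg (f j) ω (t / c (j + 1)))) + e t)) := by
  obtain ⟨rk, c, hrk, hχ, hc0, hc⟩ := exists_rank χ hχ0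
  obtain ⟨a₀, ha₀⟩ := hE
  let s : ℕ → ℝ := fun j => if j = m + 1 then 0 else c (j - 1) / c j
  obtain ⟨p, f, hp, -, hone, hf0, -, hrec⟩ := exists_weight_log_mass (Φ.Agree rk)
    (fun j => ⟨fun _ _ _ => rfl, fun h i hi => (h i hi).symm,
      fun h h' i hi => (h i hi).trans (h' i hi)⟩)
    (fun j a b h i hi => h i (hi.trans (Nat.lt_succ_self j))) s (m + 1) (fun _ => 1)
    fun _ => one_pos
  simp only [one_mul] at hone hrec
  have hP : IsProbabilityMeasure (Φ.symbMeasure p) := by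
    refine ⟨?_⟩
    rw [Φ.symbMeasure_apply fun a => (hp a).le, ← ENNReal.ofReal_one, ← hone ⟨a₀, ha₀⟩]
    simp [Agree]
  set q := f 0 ⟨a₀, ha₀⟩ with hq
  have hf0' : ∀ a, f 0 a = q := fun a => hf0 _ _ fun i hi => absurd hi (Nat.not_lt_zero _)
  refine ⟨_, hP, fun j => f (j + 1), c, q / c 0, |q|, fun t => if 0 < t then
    t * (q / c 0) - ⌊t / c 0⌋₊ * q else 0, hc0, fun t => ?_, fun t ht ω => ?_⟩
  · beta_reduce
    split_ifs with ht
    · have h1 := Nat.floor_le (div_nonneg ht.le (hc0 0).le)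
      have h2 := Nat.lt_floor_add_one (t / c 0)
      rw [show t * (q / c 0) - ⌊t / c 0⌋₊ * q = (t / c 0 - ⌊t / c 0⌋₊) * q by ring, abs_mul]
      refine mul_le_of_le_one_left (abs_nonneg _) ?_
      rw [abs_le]
      constructor <;> linarith
    · simp
  · rw [Φ.log_measure_cell hrk hχ hc0 hc hp hone hrec ht.le ω]
    congr 2
    simp only [Finset.sum_sub_distrib, ← Finset.mul_sum, if_pos ht]
    rw [Finset.sum_range_succ, Finset.sum_range_succ']
    simp only [s, if_true, zero_mul, add_zero, hf0', Finset.sum_const, Finset.card_range,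
      nsmul_eq_mul]
    have hs : ∀ j ∈ Finset.range m, (if j + 1 = m + 1 then 0 else c (j + 1 - 1) / c (j + 1)) *
        ∑ k ∈ Finset.range ⌊t / c j⌋₊, f (j + 1) (ω k) =
        t * ((c (j + 1))⁻¹ * Φ.avg (f (j + 1)) ω (t / c j)) := fun j hj => by
      have := (hc0 j).ne'
      have := (hc0 (j + 1)).ne'
      rw [if_neg (by have := Finset.mem_range.1 hj; omega), avg, Nat.add_sub_cancel]
      field_simp
    have hs' : ∀ j ∈ Finset.range m, ∑ k ∈ Finset.range ⌊t / c (j + 1)⌋₊, f (j + 1) (ω k) =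
        t * ((c (j + 1))⁻¹ * Φ.avg (f (j + 1)) ω (t / c (j + 1))) := fun j hj => by
      have := (hc0 (j + 1)).ne'
      rw [avg]
      field_simp
    rw [Finset.sum_congr rfl hs, Finset.sum_congr rfl hs', ← Finset.mul_sum, ← Finset.mul_sum]
    simp only [mul_sub, Finset.sum_sub_distrib]
    ring

end DiagIFS

namespace DiagIFS

theorem abs_avg_le (Φ : DiagIFS d A) (f : Φ.Symb → ℝ) (ω : ℕ → Φ.Symb) {M : ℝ}
    (hM : ∀ a, |f a| ≤ M) (x : ℝ) : |Φ.avg f ω x| ≤ M := by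
  have hM0 : 0 ≤ M := (abs_nonneg _).trans (hM (ω 0))
  rcases le_or_gt x 0 with hx | hx
  · simpa [avg, Nat.floor_of_nonpos hx] using hM0
  · rw [avg, abs_div, abs_of_pos hx, div_le_iff₀ hx]
    calc |∑ k ∈ Finset.range ⌊x⌋₊, f (ω k)| ≤ ∑ k ∈ Finset.range ⌊x⌋₊, |f (ω k)| :=
          Finset.abs_sum_le_sum_abs _ _
      _ ≤ ∑ k ∈ Finset.range ⌊x⌋₊, M := Finset.sum_le_sum fun k _ => hM _
      _ = ⌊x⌋₊ * M := by simp
      _ ≤ M * x := by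
        rw [mul_comm]
        exact mul_le_mul_of_nonneg_left (Nat.floor_le hx.le) hM0

theorem measurable_avg (Φ : DiagIFS d A) (f : Φ.Symb → ℝ) (ω : ℕ → Φ.Symb) :
    Measurable (Φ.avg f ω) :=
  ((measurable_from_nat (f := fun n => ∑ k ∈ Finset.range n, f (ω k))).comp
    Nat.measurable_floor).div measurable_id

theorem ae_tendsto_avg (Φ : DiagIFS d A) (P : Measure Φ.Symb) [IsProbabilityMeasure P]
    (f : Φ.Symb → ℝ) :
    ∀ᵐ ω ∂(Measure.infinitePi fun _ : ℕ => P), ∃ L, Tendsto (Φ.avg f ω) atTop (𝓝 L) := by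
  have hf : Measurable f := measurable_from_top
  have hident : ∀ k : ℕ, ProbabilityTheory.IdentDistrib (fun ω : ℕ → Φ.Symb => f (ω k))
      (fun ω => f (ω 0)) (Measure.infinitePi fun _ : ℕ => P) (Measure.infinitePi fun _ => P) := by
    intro k
    refine ProbabilityTheory.IdentDistrib.comp (u := f) ⟨(measurable_pi_apply k).aemeasurable,
      (measurable_pi_apply 0).aemeasurable, ?_⟩ hf
    exact (Measure.infinitePi_map_eval (fun _ : ℕ => P) k).trans
      (Measure.infinitePi_map_eval (fun _ : ℕ => P) 0).symm
  have hindep := ProbabilityTheory.iIndepFun_infinitePi (P := fun _ : ℕ => P)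
    (X := fun _ => f) fun _ => hf
  have hinteg : Integrable (fun ω : ℕ → Φ.Symb => f (ω 0)) (Measure.infinitePi fun _ => P) := by
    refine Integrable.of_bound (hf.comp (measurable_pi_apply 0)).aestronglyMeasurable
      (∑ a, |f a|) (ae_of_all _ fun ω => ?_)
    exact Finset.single_le_sum (f := fun a => |f a|) (fun a _ => abs_nonneg _)
      (Finset.mem_univ (ω 0))
  filter_upwards [ProbabilityTheory.strong_law_ae_real (fun k (ω : ℕ → Φ.Symb) => f (ω k)) hinteg
    (fun i j hij => hindep.indepFun hij) hident] with ω hω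
  refine ⟨_, ((hω.comp tendsto_nat_floor_atTop).mul
    (tendsto_nat_floor_div_atTop (R := ℝ))).congr' ?_⟩
  filter_upwards [eventually_ge_atTop (1 : ℝ)] with x hx
  have : (⌊x⌋₊ : ℝ) ≠ 0 := by
    exact_mod_cast (Nat.floor_pos.2 hx).ne'
  simp only [Function.comp, avg]
  field_simp

theorem measDim_map_le_dimH (Φ : DiagIFS d A) (hV : Φ.Valid) (μ : Measure (ℕ → Φ.Symb))
    [IsProbabilityMeasure μ] : measDim (Measure.map Φ.coding μ) ≤ dimH Φ.limitSet := by
  have := Measure.isProbabilityMeasure_map (μ := μ) hV.measurable_coding.aemeasurable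
  refine measDim_le_dimH _ _ ?_
  rw [Measure.map_apply hV.measurable_coding hV.isCompact_limitSet.measurableSet.compl]
  convert measure_empty (μ := μ)
  ext ω
  simp [coding_mem]

theorem dynDim_le_dimH (Φ : DiagIFS d A) (hV : Φ.Valid) : Φ.dynDim ≤ dimH Φ.limitSet := by
  refine sSup_le ?_
  rintro _ ⟨μ, hμ, -, rfl⟩
  exact Φ.measDim_map_le_dimH hV μ

theorem measDim_infinitePi_le_dynDim (Φ : DiagIFS d A) (P : Measure Φ.Symb)
    [IsProbabilityMeasure P] :
    measDim (Measure.map Φ.coding (Measure.infinitePi fun _ : ℕ => P)) ≤ Φ.dynDim := by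
  refine le_sSup ⟨_, inferInstance, ?_, rfl⟩
  exact Measure.map_infinitePi_infinitePi_of_inj (P := fun _ : ℕ => P) Nat.succ_injective

section McMullen

variable {m : ℕ} {A : Fin (m + 1) → Type} [∀ i, Fintype (A i)] {Φ : DiagIFS (m + 1) A}
  {χ : Fin (m + 1) → ℝ} {P : Measure Φ.Symb} [IsProbabilityMeasure P] {f : ℕ → Φ.Symb → ℝ}
  {c : ℕ → ℝ} {δ C K : ℝ} {e : ℝ → ℝ}

theorem dimH_limitSet_le_of_measure_cell (hV : Φ.Valid)
    (hχ : ∀ i a, |Φ.slope i a| = Real.exp (-χ i)) (hχ0 : ∀ i, 0 < χ i) (hK0 : 0 ≤ K)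
    (hK : ∀ i, Real.exp (χ i) ≤ K) (hc : ∀ j, 0 < c j) (he : ∀ t, |e t| ≤ C)
    (hcell : ∀ t > 0, ∀ ω, Measure.infinitePi (fun _ : ℕ => P) (Φ.cell χ t ω) =
      ENNReal.ofReal (Real.exp (t * (-δ + ∑ j ∈ Finset.range m, (c (j + 1))⁻¹ *
        (Φ.avg (f j) ω (t / c j) - Φ.avg (f j) ω (t / c (j + 1)))) + e t))) :
    dimH Φ.limitSet ≤ ENNReal.ofReal δ := by
  refine ENNReal.le_of_forall_pos_le_add fun ε hε _ => ?_
  set s : ℝ≥0 := (δ + ε).toNNReal with hs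
  have hs' : (s : ℝ≥0∞) ≤ ENNReal.ofReal δ + ε := by
    refine ENNReal.ofReal_add_le.trans ?_
    rw [ENNReal.ofReal_coe_nnreal]
  refine le_trans ?_ hs'
  have := Measure.isProbabilityMeasure_map (μ := Measure.infinitePi fun _ : ℕ => P)
    hV.measurable_coding.aemeasurable
  have hKs : 0 < (K + 1) ^ (s : ℝ) := Real.rpow_pos_of_pos (by positivity) _
  refine dimH_le_of_exists_le_measure_ball (Measure.map Φ.coding (Measure.infinitePi fun _ => P))
    _ s (Real.exp (-C) / (K + 1) ^ (s : ℝ)) (by positivity) ?_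
  rintro _ ⟨ω, rfl⟩ R hR
  have hlim : Tendsto (fun t : ℝ => (K + 1) * Real.exp (-t)) atTop (𝓝 0) := by
    simpa using (Real.tendsto_exp_neg_atTop_nhds_zero).const_mul (K + 1)
  obtain ⟨u₀, hu₀⟩ := eventually_atTop.1 (hlim.eventually (gt_mem_nhds hR))
  obtain ⟨u, hu, hlt⟩ := exists_neg_lt_sum_sub_translate (Finset.univ : Finset (Fin m))
    (fun j u => Φ.avg (f j) ω (Real.exp u)) (fun j => (c (j + 1))⁻¹) (fun j => Real.log (c j))
    (fun j => Real.log (c (j + 1))) (∑ j : Fin m, ∑ a, |f j a|)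
    (fun j => (Φ.measurable_avg _ ω).comp Real.measurable_exp)
    (fun j u => Φ.abs_avg_le _ ω (fun a => (Finset.single_le_sum (f := fun a => |f j a|)
      (fun a _ => abs_nonneg _) (Finset.mem_univ a)).trans (Finset.single_le_sum
      (f := fun j : Fin m => ∑ a, |f j a|) (fun j _ => Finset.sum_nonneg fun a _ => abs_nonneg _)
      (Finset.mem_univ j))) _) ε hε u₀
  simp only [Real.exp_sub, Real.exp_log (hc _)] at hlt
  rw [← Finset.sum_range (fun j => (c (j + 1))⁻¹ * (Φ.avg (f j) ω (Real.exp u / c j) -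
    Φ.avg (f j) ω (Real.exp u / c (j + 1))))] at hlt
  have ht : 0 < Real.exp u := Real.exp_pos u
  have htu : u₀ ≤ Real.exp u := by linarith [Real.add_one_le_exp u]
  set t := Real.exp u with htdef
  refine ⟨(K + 1) * Real.exp (-t), by positivity, hu₀ t htu, ?_⟩
  calc ENNReal.ofReal (Real.exp (-C) / (K + 1) ^ (s : ℝ) *
        ((K + 1) * Real.exp (-t)) ^ (s : ℝ))
      ≤ Measure.infinitePi (fun _ : ℕ => P) (Φ.cell χ t ω) := by
        rw [hcell t ht ω]
        refine ENNReal.ofReal_le_ofReal ?_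
        rw [Real.mul_rpow (by positivity) (Real.exp_pos _).le, ← mul_assoc,
          div_mul_cancel₀ _ hKs.ne', ← Real.exp_mul, ← Real.exp_add, Real.exp_le_exp]
        have h1 : δ + ε ≤ s := Real.le_coe_toNNReal _
        have h2 := (abs_le.1 (he t)).1
        nlinarith
    _ ≤ Measure.infinitePi (fun _ : ℕ => P) (Φ.coding ⁻¹' ball (Φ.coding ω)
          ((K + 1) * Real.exp (-t))) := by
        refine measure_mono fun ω' hω' => ?_
        refine mem_ball.2 ((dist_coding_le_of_mem_cell hV hχ hχ0 hK0 hK ht.le hω').trans_lt ?_)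
        have := Real.exp_pos (-t)
        linarith
    _ = _ := (Measure.map_apply hV.measurable_coding measurableSet_ball).symm

theorem le_measDim_of_measure_cell (hV : Φ.Valid)
    (hχ : ∀ i a, |Φ.slope i a| = Real.exp (-χ i)) (hχ0 : ∀ i, 0 < χ i)
    (hgood : ∀ x > 0, Φ.GoodIdx (Finset.univ.filter fun i => χ i ≤ x)) (hK0 : 0 ≤ K)
    (hK : ∀ i, Real.exp (χ i) ≤ K) (hc : ∀ j, 0 < c j) (he : ∀ t, |e t| ≤ C)
    (hcell : ∀ t > 0, ∀ ω, Measure.infinitePi (fun _ : ℕ => P) (Φ.cell χ t ω) =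
      ENNReal.ofReal (Real.exp (t * (-δ + ∑ j ∈ Finset.range m, (c (j + 1))⁻¹ *
        (Φ.avg (f j) ω (t / c j) - Φ.avg (f j) ω (t / c (j + 1)))) + e t))) :
    ENNReal.ofReal δ ≤ measDim (Measure.map Φ.coding (Measure.infinitePi fun _ : ℕ => P)) := by
  refine ENNReal.le_of_forall_pos_le_add fun ε hε _ => ?_
  set μ := Measure.infinitePi fun _ : ℕ => P with hμ
  have hprob := Measure.isProbabilityMeasure_map (μ := μ) hV.measurable_coding.aemeasurable
  rw [← tsub_le_iff_right, ← ENNReal.ofReal_coe_nnreal, ← ENNReal.ofReal_sub _ ε.coe_nonneg]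
  rcases le_or_gt (δ - ε) 0 with hδ | hδ
  · rw [ENNReal.ofReal_of_nonpos hδ]
    exact zero_le
  set G : ℕ → Set (ℕ → Φ.Symb) := fun n => {ω | ∀ t ≥ (n : ℝ), 0 < t →
    μ (Φ.cell χ t ω) ≤ ENNReal.ofReal (Real.exp C * Real.exp (-t * (δ - ε)))} with hG
  have hae : ∀ᵐ ω ∂μ, ω ∈ ⋃ n, G n := by
    have h : ∀ᵐ ω ∂μ, ∀ j, ∃ L, Tendsto (Φ.avg (f j) ω) atTop (𝓝 L) :=
      ae_all_iff.2 fun j => Φ.ae_tendsto_avg P (f j)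
    filter_upwards [h] with ω hω
    have hlim : Tendsto (fun t => ∑ j ∈ Finset.range m, (c (j + 1))⁻¹ *
        (Φ.avg (f j) ω (t / c j) - Φ.avg (f j) ω (t / c (j + 1)))) atTop (𝓝 0) := by
      rw [show (0 : ℝ) = ∑ j ∈ Finset.range m, 0 by simp]
      refine tendsto_finsetSum _ fun j _ => ?_
      obtain ⟨L, hL⟩ := hω j
      simpa using ((hL.comp (tendsto_id.atTop_div_const (hc j))).sub
        (hL.comp (tendsto_id.atTop_div_const (hc (j + 1))))).const_mul (c (j + 1))⁻¹
    obtain ⟨t₀, ht₀⟩ := eventually_atTop.1 (hlim.eventually (gt_mem_nhds (NNReal.coe_pos.2 hε)))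
    obtain ⟨n, hn⟩ := exists_nat_ge t₀
    refine mem_iUnion.2 ⟨n, fun t htn ht => ?_⟩
    rw [hcell t ht ω, ← Real.exp_add]
    refine ENNReal.ofReal_le_ofReal (Real.exp_le_exp.2 ?_)
    exact (add_le_add (mul_le_mul_of_nonneg_left
      (add_le_add le_rfl (ht₀ t (hn.trans htn)).le) ht.le) (abs_le.1 (he t)).2).trans
      (le_of_eq (by ring))
  obtain ⟨n, hn⟩ : ∃ n, μ (G n) ≠ 0 := by
    by_contra! hnull
    have h0 : μ (⋃ n, G n) = 0 := measure_iUnion_null hnull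
    have h1 : ∀ᵐ ω ∂μ, False := by
      filter_upwards [hae, measure_eq_zero_iff_ae_notMem.1 h0] with ω h h' using h' h
    exact IsProbabilityMeasure.ne_zero μ (by simpa using h1)
  have key := le_measDim_of_measure_ball_le (Measure.map Φ.coding μ)
    (Measure.map Φ.coding (μ.restrict (G n))) (Measure.map_mono Measure.restrict_le_self
      hV.measurable_coding) ?_ (δ - ε).toNNReal ((2 * (K + 1)) ^ (m + 1) * Real.exp C)
    (Real.exp (-((n : ℝ) + 1))) (by positivity) (Real.exp_pos _) ?_
  · exact key
  · intro h
    apply hn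
    rw [← Measure.restrict_apply_univ, ← Set.preimage_univ (f := Φ.coding),
      ← Measure.map_apply hV.measurable_coding MeasurableSet.univ, h]
    rfl
  intro x ρ hρ hρn
  obtain ⟨t, rfl⟩ : ∃ t, Real.exp (-t) = ρ := ⟨-Real.log ρ, by rw [neg_neg, Real.exp_log hρ]⟩
  rw [Real.exp_lt_exp] at hρn
  have ht : 0 < t := by have := n.cast_nonneg (α := ℝ); linarith
  rw [Measure.map_apply hV.measurable_coding measurableSet_ball,
    Measure.restrict_apply (hV.measurable_coding measurableSet_ball)]
  obtain ⟨W, hWS, hcov, hW⟩ := Φ.exists_finite_cell_cover χ t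
    (Φ.coding ⁻¹' ball x (Real.exp (-t)) ∩ G n)
  have hcard := card_le_of_pairwise_not_mem_cell hV hχ hχ0 hgood hK0 hK ht.le x W
    (fun ω hω => (hWS hω).1) hW
  rw [Real.coe_toNNReal _ hδ.le, ← Real.exp_mul]
  calc μ (Φ.coding ⁻¹' ball x (Real.exp (-t)) ∩ G n) ≤ μ (⋃ ω ∈ W, Φ.cell χ t ω) :=
        measure_mono hcov
    _ ≤ ∑ ω ∈ W, μ (Φ.cell χ t ω) := measure_biUnion_finset_le _ _
    _ ≤ ∑ ω ∈ W, ENNReal.ofReal (Real.exp C * Real.exp (-t * (δ - ε))) :=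
        Finset.sum_le_sum fun ω hω => (hWS hω).2 t (by linarith) ht
    _ = ENNReal.ofReal (W.card * (Real.exp C * Real.exp (-t * (δ - ε)))) := by
        rw [Finset.sum_const, nsmul_eq_mul, ← ENNReal.ofReal_natCast,
          ← ENNReal.ofReal_mul (by positivity)]
    _ ≤ _ := by
        rw [mul_assoc]
        exact ENNReal.ofReal_le_ofReal (mul_le_mul_of_nonneg_right hcard (by positivity))

end McMullen

theorem dimH_limitSet_le_dynDim (Φ : DiagIFS d A) (hV : Φ.Valid) {χ : Fin d → ℝ}
    (hχ : ∀ i a, |Φ.slope i a| = Real.exp (-χ i)) (hχ0 : ∀ i, 0 < χ i)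
    (hgood : ∀ x > 0, Φ.GoodIdx (Finset.univ.filter fun i => χ i ≤ x)) :
    dimH Φ.limitSet ≤ Φ.dynDim := by
  cases d with
  | zero =>
    rw [dimH_subsingleton (fun x _ y _ => Subsingleton.elim x y)]
    exact zero_le
  | succ m =>
    obtain ⟨P, hP, f, c, δ, C, e, hc, he, hcell⟩ := Φ.exists_measure_cell_eq hV.1 hχ0
    have hK0 : 0 ≤ ∑ i, Real.exp (χ i) := Finset.sum_nonneg fun i _ => (Real.exp_pos _).le
    have hK : ∀ i, Real.exp (χ i) ≤ ∑ i, Real.exp (χ i) := fun i =>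
      Finset.single_le_sum (f := fun i => Real.exp (χ i)) (fun i _ => (Real.exp_pos _).le)
        (Finset.mem_univ i)
    exact (dimH_limitSet_le_of_measure_cell hV hχ hχ0 hK0 hK hc he hcell).trans
      ((le_measDim_of_measure_cell hV hχ hχ0 hgood hK0 hK hc he hcell).trans
        (Φ.measDim_infinitePi_le_dynDim P))

end DiagIFS

/-- For a good sponge whose contraction ratios `|φ'_{i,a}|` do not depend on
`a ∈ A_i`, the Hausdorff and dynamical dimensions coincide. -/
theorem dimH_eq_dynDim_of_const_ratios {d : ℕ} {A : Fin d → Type} [∀ i, Fintype (A i)]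
    (Φ : DiagIFS d A) (hV : Φ.Valid)
    (hGood : ∀ p : Φ.Symb → ℝ, IsProbVec p → Φ.GoodVec p)
    (hratio : ∀ i : Fin d, ∀ a b : A i, |Φ.slope i a| = |Φ.slope i b|) :
    dimH Φ.limitSet = Φ.dynDim := by
  refine le_antisymm ?_ (Φ.dynDim_le_dimH hV)
  obtain ⟨a₀, ha₀⟩ := hV.1
  have hpos : ∀ i, 0 < |Φ.slope i (a₀ i)| := fun i => abs_pos.2 (hV.2.1 i _)
  refine Φ.dimH_limitSet_le_dynDim hV (χ := fun i => -Real.log |Φ.slope i (a₀ i)|)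
    (fun i a => ?_) (fun i => neg_pos.2 (Real.log_neg (hpos i) (hV.2.2.1 i _))) fun x hx => ?_
  · rw [neg_neg, Real.exp_log (hpos i), hratio i a (a₀ i)]
  · have h := hGood (Pi.single ⟨a₀, ha₀⟩ 1)
      ⟨fun a => by rw [Pi.single_apply]; split_ifs <;> norm_num, by simp⟩ x hx
    have hchi : ∀ i, Φ.chi i (Pi.single ⟨a₀, ha₀⟩ 1) = -Real.log |Φ.slope i (a₀ i)| := fun i => by
      simp [DiagIFS.chi, Pi.single_apply]
    simpa only [hchi] using h

end SelfAffineSponge
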